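/- For all h, c ∈ ℝ⟨⟨X⟩⟩ and all d ∈ G, the composition product and the mixed composition product satisfy the mixed associativity h ∘ (c ◁ d) = (h ∘ c) ◁ d. -/

import Mathlib

open scoped Classical

/-!  Common setup: noncommutative formal power series ℝ⟨⟨X⟩⟩ over the
alphabet X = {x₀, x₁}.  Words are encoded as lists over `Fin 2`
(the letter `0` is x₀ and `1` is x₁); a series is a function from words
to ℝ, recording its coefficients. -/

/-- Words over the alphabet X = {x₀, x₁}. -/
abbrev Word : Type := List (Fin 2)

/-- Noncommutative formal power series ℝ⟨⟨X⟩⟩. -/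
abbrev Ser : Type := Word → ℝ

/-- The series 𝟙 (the empty word). -/
def one1 : Ser := fun w => if w = [] then 1 else 0

/-- A single word η regarded as a series. -/
def mono (η : Word) : Ser := fun w => if w = η then 1 else 0

/-- Left concatenation of a series by the letter `x_i`. -/
def lc (i : Fin 2) (c : Ser) : Ser := fun w =>
  match w with
  | [] => 0
  | j :: u => if j = i then c u else 0

/-- Auxiliary recursion computing the coefficient of a word `w` in `c ⧢ d`:
`(c ⧢ d)(𝟙) = c(𝟙) d(𝟙)` and
`(c ⧢ d)(x_i w) = ((x_i⁻¹ c) ⧢ d)(w) + (c ⧢ (x_i⁻¹ d))(w)`,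
where `x_i⁻¹` is the left shift.  This dual recursion is exactly the
bilinear extension of the inductive shuffle of words
`(x_i ξ) ⧢ (x_j η) = x_i (ξ ⧢ x_j η) + x_j (x_i ξ ⧢ η)`, `𝟙 ⧢ η = η ⧢ 𝟙 = η`. -/
def shAux : Word → Ser → Ser → ℝ
  | [], c, d => c [] * d []
  | i :: w, c, d => shAux w (fun u => c (i :: u)) d + shAux w c (fun u => d (i :: u))

/-- The shuffle product `⧢` on ℝ⟨⟨X⟩⟩. -/
def sh (c d : Ser) : Ser := fun w => shAux w c d

/-- Shuffle powers `c^{⧢ k}`. -/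
def shPow (c : Ser) : ℕ → Ser
  | 0 => one1
  | k + 1 => sh c (shPow c k)

/-- The shuffle inverse `c^{⧢ -1} = Σ_{k ≥ 0} (𝟙 - c)^{⧢ k}`.
When `c(𝟙) = 1` the sum is locally finite (for each word only finitely many
terms are nonzero) and `∑'` returns it. -/
noncomputable def shInv (c : Ser) : Ser := fun w => ∑' k : ℕ, shPow (one1 - c) k w

/-- Composition product restricted to words: `𝟙 ∘ d = 𝟙`,
`(x₀ η) ∘ d = x₀ (η ∘ d)`, `(x₁ η) ∘ d = x₀ (d ⧢ (η ∘ d))`. -/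
def wordComp : Word → Ser → Ser
  | [], _ => one1
  | i :: η, d => if i = 0 then lc 0 (wordComp η d) else lc 0 (sh d (wordComp η d))

/-- The composition product `c ∘ d = Σ_η c(η) (η ∘ d)`.  For each fixed word
only finitely many terms are nonzero, and `∑'` returns the sum. -/
noncomputable def comp (c d : Ser) : Ser := fun w => ∑' η : Word, c η * wordComp η d w

/-- Membership in the set `G`: pairs `(d₁, d₂)` with `d₁(𝟙) = 1`. -/
def inG (d : Ser × Ser) : Prop := d.1 [] = 1

/-- Mixed composition product restricted to words: `𝟙 ◁ d = 𝟙`,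
`(x₀ η) ◁ d = x₀ (η ◁ d)`,
`(x₁ η) ◁ d = x₁ (d₁ ⧢ (η ◁ d)) + x₀ (d₂ ⧢ (η ◁ d))`. -/
def wordMComp : Word → Ser × Ser → Ser
  | [], _ => one1
  | i :: η, d =>
      if i = 0 then lc 0 (wordMComp η d)
      else lc 1 (sh d.1 (wordMComp η d)) + lc 0 (sh d.2 (wordMComp η d))

/-- The mixed composition product `c ◁ d = Σ_η c(η) (η ◁ d)`. -/
noncomputable def mcomp (c : Ser) (d : Ser × Ser) : Ser :=
  fun w => ∑' η : Word, c η * wordMComp η d w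

/-- Componentwise mixed composition `c ⊲ d = (c₁ ◁ d, c₂ ◁ d)`. -/
noncomputable def tri (c d : Ser × Ser) : Ser × Ser := (mcomp c.1 d, mcomp c.2 d)

/-- Componentwise composition `d ∘̄ c = (d₁ ∘ c, d₂ ∘ c)`. -/
noncomputable def bcomp (d : Ser × Ser) (c : Ser) : Ser × Ser := (comp d.1 c, comp d.2 c)

/-- The group product `⊙` on `G`:
`(c₁, c₂) ⊙ (d₁, d₂) = (c₁ ⧢ d₁, c₂ + d₂ ⧢ c₁)`. -/
def odot (c d : Ser × Ser) : Ser × Ser := (sh c.1 d.1, c.2 + sh d.2 c.1)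

/-- The identity element `e = (𝟙, 0)`. -/
def eG : Ser × Ser := (one1, 0)

/-- The `⊙`-inverse `c^{⊙ -1} = (c₁^{⧢ -1}, -(c₁^{⧢ -1} ⧢ c₂))`. -/
noncomputable def odotInv (c : Ser × Ser) : Ser × Ser :=
  (shInv c.1, -(sh (shInv c.1) c.2))

/-- The affine feedback group product `c ⋆ d = (c ⊲ d) ⊙ d` on `G`. -/
noncomputable def star (c d : Ser × Ser) : Ser × Ser := odot (tri c d) d

/-- The `⋆`-inverse of an element of `G` (defined via choice; for an element
of the group `(G, ⋆)` it is the unique two-sided `⋆`-inverse). -/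
noncomputable def starInv (x : Ser × Ser) : Ser × Ser :=
  if h : ∃ y : Ser × Ser, inG y ∧ star x y = eG ∧ star y x = eG then h.choose else x

/-- The affine feedback product `c @ d = c ◁ ((d^{⊙ -1}) ∘̄ c)^{⋆ -1}`. -/
noncomputable def atp (c : Ser) (d : Ser × Ser) : Ser :=
  mcomp c (starInv (bcomp (odotInv d) c))

/-- Membership in ℝ[[x₀]]: series vanishing on every word containing x₁. -/
def inRx0 (c : Ser) : Prop := ∀ w : Word, (1 : Fin 2) ∈ w → c w = 0

/-- The left shift `x_i⁻¹ c` of a series by the letter `x_i`. -/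
def shift (i : Fin 2) (c : Ser) : Ser := fun u => c (i :: u)

theorem sh_nil (a b : Ser) : sh a b [] = a [] * b [] := rfl

theorem sh_cons (a b : Ser) (i : Fin 2) (w : Word) :
    sh a b (i :: w) = sh (shift i a) b w + sh a (shift i b) w := rfl

theorem shift_sh (a b : Ser) (i : Fin 2) :
    shift i (sh a b) = sh (shift i a) b + sh a (shift i b) := rfl

theorem shift_add (a b : Ser) (i : Fin 2) : shift i (a + b) = shift i a + shift i b := rfl

/-- The coefficient of `w` in a shuffle product depends only on the coefficients of the factors
at words no longer than `w`. -/
theorem sh_congr {a a' b b' : Ser} {w : Word} (ha : ∀ v : Word, v.length ≤ w.length → a v = a' v)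
    (hb : ∀ v : Word, v.length ≤ w.length → b v = b' v) : sh a b w = sh a' b' w := by
  induction w generalizing a a' b b' with
  | nil => simp [sh_nil, ha [] le_rfl, hb [] le_rfl]
  | cons i w ih =>
    have hw : w.length ≤ (i :: w).length := by simp
    rw [sh_cons, sh_cons]
    congr 1
    · exact ih (fun v hv => ha (i :: v) (by simpa using hv)) fun v hv => hb v (hv.trans hw)
    · exact ih (fun v hv => ha v (hv.trans hw)) fun v hv => hb (i :: v) (by simpa using hv)

theorem sh_comm (a b : Ser) : sh a b = sh b a := by
  funext w
  induction w generalizing a b with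
  | nil => exact mul_comm _ _
  | cons i w ih => rw [sh_cons, sh_cons, ih, ih a, add_comm]

theorem sh_add (a b c : Ser) : sh a (b + c) = sh a b + sh a c := by
  funext w
  induction w generalizing a b c with
  | nil => exact mul_add _ _ _
  | cons i w ih =>
    simp only [Pi.add_apply, sh_cons, shift_add, ih]
    ring

theorem add_sh (a b c : Ser) : sh (a + b) c = sh a c + sh b c := by
  rw [sh_comm, sh_add, sh_comm c, sh_comm c]

theorem sh_zero (a : Ser) : sh a 0 = 0 := by
  simpa using sh_add a 0 0

theorem sh_assoc (a b c : Ser) : sh (sh a b) c = sh a (sh b c) := by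
  funext w
  induction w generalizing a b c with
  | nil => exact mul_assoc _ _ _
  | cons i w ih =>
    simp only [sh_cons, shift_sh, add_sh, sh_add, Pi.add_apply, ih]
    ring

theorem sh_left_comm (a b c : Ser) : sh a (sh b c) = sh b (sh a c) := by
  rw [← sh_assoc, sh_comm a b, sh_assoc]

theorem sh_smul (r : ℝ) (a b : Ser) : sh a (r • b) = r • sh a b := by
  funext w
  induction w generalizing a b with
  | nil => exact mul_left_comm _ _ _
  | cons i w ih =>
    have hs : shift i (r • b) = r • shift i b := rfl
    rw [sh_cons, hs, ih, ih]
    exact (smul_add r _ _).symm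

theorem sh_eq_zero_of_length_lt {n : ℕ} (a : Ser) {b : Ser}
    (hb : ∀ v : Word, v.length < n → b v = 0) {w : Word} (hw : w.length < n) : sh a b w = 0 := by
  rw [sh_congr (a' := a) (b' := 0) (fun _ _ => rfl) fun v hv => hb v (hv.trans_lt hw), sh_zero]
  rfl

/-- Shuffling by a fixed series commutes with pointwise convergent sums. -/
theorem hasSum_sh {ι : Type*} {F : ι → Ser} {g : Ser} (a : Ser)
    (hF : ∀ w, HasSum (fun j => F j w) (g w)) (w : Word) :
    HasSum (fun j => sh a (F j) w) (sh a g w) := by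
  induction w generalizing a F g with
  | nil => exact (hF []).mul_left _
  | cons i w ih => exact (ih (shift i a) hF).add (ih a fun v => hF (i :: v))

theorem lc_nil (i : Fin 2) (c : Ser) : lc i c [] = 0 := rfl

theorem lc_cons (i j : Fin 2) (c : Ser) (u : Word) :
    lc i c (j :: u) = if j = i then c u else 0 := rfl

theorem lc_eq_zero_of_length_lt {n : ℕ} (i : Fin 2) {b : Ser}
    (hb : ∀ v : Word, v.length < n → b v = 0) {w : Word} (hw : w.length < n + 1) :
    lc i b w = 0 := by
  cases w with
  | nil => rfl
  | cons j u => rw [lc_cons, hb u (by simpa using hw), ite_self]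

theorem wordComp_eq_zero_of_length_lt (d : Ser) {η w : Word} (hw : w.length < η.length) :
    wordComp η d w = 0 := by
  induction η generalizing w with
  | nil => simp at hw
  | cons i η ih =>
    rw [wordComp]
    split_ifs
    · exact lc_eq_zero_of_length_lt 0 (fun v => ih) hw
    · exact lc_eq_zero_of_length_lt 0 (fun v => sh_eq_zero_of_length_lt d fun v => ih) hw

theorem wordMComp_eq_zero_of_length_lt (d : Ser × Ser) {η w : Word} (hw : w.length < η.length) :
    wordMComp η d w = 0 := by
  induction η generalizing w with
  | nil => simp at hw
  | cons i η ih =>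
    rw [wordMComp]
    split_ifs
    · exact lc_eq_zero_of_length_lt 0 (fun v => ih) hw
    · rw [Pi.add_apply,
        lc_eq_zero_of_length_lt 1 (fun v => sh_eq_zero_of_length_lt d.1 fun v => ih) hw,
        lc_eq_zero_of_length_lt 0 (fun v => sh_eq_zero_of_length_lt d.2 fun v => ih) hw, add_zero]

theorem summable_of_length_lt {f : Word → ℝ} (n : ℕ) (hf : ∀ η : Word, n < η.length → f η = 0) :
    Summable f :=
  summable_of_hasFiniteSupport <| (List.finite_length_le (Fin 2) n).subset fun η hη =>
    not_lt.1 fun h => hη (hf η h)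

theorem hasSum_comp (c d : Ser) (w : Word) :
    HasSum (fun η : Word => c η * wordComp η d w) (comp c d w) :=
  (summable_of_length_lt w.length fun η h => by
    rw [wordComp_eq_zero_of_length_lt d h, mul_zero]).hasSum

theorem hasSum_mcomp (c : Ser) (d : Ser × Ser) (w : Word) :
    HasSum (fun η : Word => c η * wordMComp η d w) (mcomp c d w) :=
  (summable_of_length_lt w.length fun η h => by
    rw [wordMComp_eq_zero_of_length_lt d h, mul_zero]).hasSum

/-- A sum over words splits according to the first letter. -/
theorem hasSum_word {f : Word → ℝ} {a b : ℝ} (h₀ : HasSum (fun η => f (0 :: η)) a)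
    (h₁ : HasSum (fun η => f (1 :: η)) b) : HasSum f (f [] + a + b) := by
  have inj (i : Fin 2) : Function.Injective (List.cons i) := List.cons_injective
  have key := ((hasSum_ite_eq ([] : Word) (f [])).add ((hasSum_extend_zero (inj 0)).2 h₀)).add
    ((hasSum_extend_zero (inj 1)).2 h₁)
  convert key using 2 with η
  rcases η with _ | ⟨i, η⟩
  · rw [Function.extend_apply' _ _ _ (by simp), Function.extend_apply' _ _ _ (by simp)]
    simp
  · fin_cases i <;> simp

theorem comp_nil (c d : Ser) : comp c d [] = c [] := by
  refine (hasSum_comp c d []).unique ?_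
  convert hasSum_single ([] : Word) fun η hη => ?_ using 1
  · simp [wordComp, one1]
  · have hlen : ([] : Word).length < η.length := List.length_pos_iff.2 hη
    rw [wordComp_eq_zero_of_length_lt d hlen, mul_zero]

theorem mcomp_nil (c : Ser) (d : Ser × Ser) : mcomp c d [] = c [] := by
  refine (hasSum_mcomp c d []).unique ?_
  convert hasSum_single ([] : Word) fun η hη => ?_ using 1
  · simp [wordMComp, one1]
  · have hlen : ([] : Word).length < η.length := List.length_pos_iff.2 hη
    rw [wordMComp_eq_zero_of_length_lt d hlen, mul_zero]

theorem hasSum_sh_comp (a c d : Ser) (w : Word) :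
    HasSum (fun η : Word => c η * sh a (wordComp η d) w) (sh a (comp c d) w) := by
  have key := hasSum_sh (F := fun η => c η • wordComp η d) a (fun v => hasSum_comp c d v) w
  simpa only [sh_smul, Pi.smul_apply, smul_eq_mul] using key

theorem hasSum_sh_mcomp (a c : Ser) (d : Ser × Ser) (w : Word) :
    HasSum (fun η : Word => c η * sh a (wordMComp η d) w) (sh a (mcomp c d) w) := by
  have key := hasSum_sh (F := fun η => c η • wordMComp η d) a (fun v => hasSum_mcomp c d v) w
  simpa only [sh_smul, Pi.smul_apply, smul_eq_mul] using key

theorem shift_zero_comp (c d : Ser) :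
    shift 0 (comp c d) = comp (shift 0 c) d + sh d (comp (shift 1 c) d) := by
  funext u
  refine (hasSum_comp c d (0 :: u)).unique ?_
  convert hasSum_word (f := fun η => c η * wordComp η d (0 :: u))
    (a := comp (shift 0 c) d u) (b := sh d (comp (shift 1 c) d) u) ?_ ?_ using 1
  · simp [wordComp, one1]
  · simpa [wordComp, lc_cons, shift] using hasSum_comp (shift 0 c) d u
  · simpa [wordComp, lc_cons, shift] using hasSum_sh_comp d (shift 1 c) d u

theorem shift_one_comp (c d : Ser) : shift 1 (comp c d) = 0 := by
  funext u
  refine (hasSum_comp c d (1 :: u)).unique ?_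
  rw [Pi.zero_apply]
  convert hasSum_zero using 2 with η
  rcases η with _ | ⟨i, η⟩
  · simp [wordComp, one1]
  · rw [wordComp]
    split_ifs <;> simp [lc_cons]

theorem shift_zero_mcomp (c : Ser) (d : Ser × Ser) :
    shift 0 (mcomp c d) = mcomp (shift 0 c) d + sh d.2 (mcomp (shift 1 c) d) := by
  funext u
  refine (hasSum_mcomp c d (0 :: u)).unique ?_
  convert hasSum_word (f := fun η => c η * wordMComp η d (0 :: u))
    (a := mcomp (shift 0 c) d u) (b := sh d.2 (mcomp (shift 1 c) d) u) ?_ ?_ using 1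
  · simp [wordMComp, one1]
  · simpa [wordMComp, lc_cons, shift] using hasSum_mcomp (shift 0 c) d u
  · simpa [wordMComp, lc_cons, shift] using hasSum_sh_mcomp d.2 (shift 1 c) d u

theorem shift_one_mcomp (c : Ser) (d : Ser × Ser) :
    shift 1 (mcomp c d) = sh d.1 (mcomp (shift 1 c) d) := by
  funext u
  refine (hasSum_mcomp c d (1 :: u)).unique ?_
  convert hasSum_word (f := fun η => c η * wordMComp η d (1 :: u))
    (a := 0) (b := sh d.1 (mcomp (shift 1 c) d) u) ?_ ?_ using 1
  · simp [wordMComp, one1]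
  · simp [wordMComp, lc_cons]
  · simpa [wordMComp, lc_cons, shift] using hasSum_sh_mcomp d.1 (shift 1 c) d u

theorem add_mcomp (a b : Ser) (d : Ser × Ser) : mcomp (a + b) d = mcomp a d + mcomp b d := by
  funext w
  refine (hasSum_mcomp (a + b) d w).unique ?_
  simpa [add_mul] using (hasSum_mcomp a d w).add (hasSum_mcomp b d w)

theorem zero_mcomp (d : Ser × Ser) : mcomp 0 d = 0 := by
  simpa using add_mcomp 0 0 d

/-- Induction on words in which the property may be assumed for all words no longer than the
tail. -/
theorem word_length_induction {P : Word → Prop} (nil : P [])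
    (cons : ∀ i u, (∀ v : Word, v.length ≤ u.length → P v) → P (i :: u)) (w : Word) : P w := by
  induction hn : w.length using Nat.strong_induction_on generalizing w with
  | _ n ih =>
    cases w with
    | nil => exact nil
    | cons i u =>
      subst hn
      exact cons i u fun v hv => ih v.length (by simpa using Nat.lt_succ_of_le hv) v rfl

/-- Mixed composition is a homomorphism for the shuffle product. -/
theorem sh_mcomp (a b : Ser) (d : Ser × Ser) :
    mcomp (sh a b) d = sh (mcomp a d) (mcomp b d) := by
  suffices h : ∀ w : Word, ∀ a b : Ser, mcomp (sh a b) d w = sh (mcomp a d) (mcomp b d) w from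
    funext fun w => h w a b
  intro w
  induction w using word_length_induction with
  | nil =>
    intro a b
    simp only [mcomp_nil, sh_nil]
  | cons i u ih =>
    intro a b
    have hu := ih u le_rfl
    have hsh (e a b : Ser) : sh e (mcomp (sh a b) d) u = sh e (sh (mcomp a d) (mcomp b d)) u :=
      sh_congr (fun _ _ => rfl) fun v hv => ih v hv a b
    change shift i (mcomp (sh a b) d) u = shift i (sh (mcomp a d) (mcomp b d)) u
    fin_cases i
    · simp only [Fin.zero_eta, shift_zero_mcomp, shift_sh, add_mcomp, sh_add, add_sh,
        Pi.add_apply, hu, hsh, sh_assoc, sh_left_comm (mcomp a d) d.2]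
      ring
    · simp only [Fin.mk_one, shift_one_mcomp, shift_sh, add_mcomp, sh_add,
        Pi.add_apply, hsh, sh_assoc, sh_left_comm (mcomp a d) d.1]

/-- mixed associativity of the composition product and the
mixed composition product: `h ∘ (c ◁ d) = (h ∘ c) ◁ d` for all `d ∈ G`. -/
theorem comp_mcomp_mixed_assoc (h c : Ser) (d : Ser × Ser) (hd : inG d) :
    comp h (mcomp c d) = mcomp (comp h c) d := by
  suffices key : ∀ w : Word, ∀ h : Ser, comp h (mcomp c d) w = mcomp (comp h c) d w from
    funext fun w => key w h
  intro w
  induction w using word_length_induction with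
  | nil =>
    intro h
    simp only [comp_nil, mcomp_nil]
  | cons i u ih =>
    intro h
    change shift i (comp h (mcomp c d)) u = shift i (mcomp (comp h c) d) u
    fin_cases i
    · have hsh : sh (mcomp c d) (comp (shift 1 h) (mcomp c d)) u =
          sh (mcomp c d) (mcomp (comp (shift 1 h) c) d) u :=
        sh_congr (fun _ _ => rfl) fun v hv => ih v hv _
      simp only [Fin.zero_eta, shift_zero_comp, shift_zero_mcomp, shift_one_comp, zero_mcomp,
        sh_zero, add_mcomp, sh_mcomp, Pi.add_apply, Pi.zero_apply, add_zero, ih u le_rfl, hsh]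
    · simp only [Fin.mk_one, shift_one_comp, shift_one_mcomp, zero_mcomp, sh_zero]
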